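/- Let r ≥ 2 and n ≥ 1 be integers, let H ⊆ {1,...,r,⋆}^{[n]} be a partial class, and let i ∈ [n]. Then there exists j ∈ {1,...,r} such that s(H_{i→j}) ≤ ((r-1)/r)·s(H). -/

import Mathlib

/-- A set `S ⊆ [n]` is shattered by a partial class `H ⊆ {1,…,r,⋆}^[n]`
(`⋆` is encoded as `none`) if the restriction of `H` to `S` contains every
total function `S → {1,…,r}`. -/
def IsShattered (n r : ℕ) (H : Set (Fin n → Option (Fin r))) (S : Finset (Fin n)) : Prop :=
  ∀ g : Fin n → Fin r, ∃ h ∈ H, ∀ i ∈ S, h i = some (g i)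

/-- The shattering strength `s(H)`: the number of subsets of `[n]` shattered by `H`. -/
noncomputable def shatterStrength (n r : ℕ) (H : Set (Fin n → Option (Fin r))) : ℕ :=
  {S : Finset (Fin n) | IsShattered n r H S}.ncard

theorem IsShattered.mono {n r : ℕ} {H K : Set (Fin n → Option (Fin r))} {S : Finset (Fin n)}
    (hS : IsShattered n r H S) (hHK : H ⊆ K) : IsShattered n r K S := fun g =>
  let ⟨h, hh, hg⟩ := hS g
  ⟨h, hHK hh, hg⟩

theorem IsShattered.notMem_of_restrict {n r : ℕ} (hr : 2 ≤ r)
    {H : Set (Fin n → Option (Fin r))} {i : Fin n} {j : Fin r} {S : Finset (Fin n)}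
    (hS : IsShattered n r {h ∈ H | h i = some j} S) : i ∉ S := by
  intro hi
  have : Nontrivial (Fin r) := Fin.nontrivial_iff_two_le.mpr hr
  obtain ⟨k, hk⟩ := exists_ne j
  obtain ⟨h, ⟨-, hj⟩, hg⟩ := hS fun _ => k
  have h_eq := hg i hi
  rw [hj, Option.some_inj] at h_eq
  exact hk h_eq.symm

theorem IsShattered.insert_of_forall_restrict {n r : ℕ}
    {H : Set (Fin n → Option (Fin r))} {i : Fin n} {S : Finset (Fin n)}
    (hS : ∀ j, IsShattered n r {h ∈ H | h i = some j} S) :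
    IsShattered n r H (insert i S) := by
  intro g
  obtain ⟨h, ⟨hh, hi⟩, hg⟩ := hS (g i) g
  refine ⟨h, hh, fun k hk => ?_⟩
  rcases Finset.mem_insert.mp hk with rfl | hk
  exacts [hi, hg k hk]

open Classical in
theorem shatterStrength_eq_card (n r : ℕ) (H : Set (Fin n → Option (Fin r))) :
    shatterStrength n r H = (Finset.univ.filter (IsShattered n r H)).card := by
  rw [shatterStrength, ← Set.ncard_coe_finset]
  simp

open Classical in
theorem card_restrict_shattering_le {n r : ℕ} (hr : 2 ≤ r)
    (H : Set (Fin n → Option (Fin r))) (i : Fin n) (S : Finset (Fin n)) :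
    (Finset.univ.filter fun j => IsShattered n r {h ∈ H | h i = some j} S).card ≤
      (r - 1) * ((if IsShattered n r H S ∧ i ∉ S then 1 else 0) +
        (if IsShattered n r H (insert i S) ∧ i ∉ S then 1 else 0)) := by
  set J := Finset.univ.filter fun j => IsShattered n r {h ∈ H | h i = some j} S
  rcases J.eq_empty_or_nonempty with h_empty | ⟨j, hj⟩
  · simp [h_empty]
  · have hjS : IsShattered n r {h ∈ H | h i = some j} S := (Finset.mem_filter.mp hj).2
    have hi := hjS.notMem_of_restrict hr
    have hS : IsShattered n r H S := hjS.mono (Set.sep_subset _ _)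
    have h_card : J.card ≤ r := by simpa using J.card_le_univ
    by_cases h_all : J = Finset.univ
    · have h_ins : IsShattered n r H (insert i S) :=
        IsShattered.insert_of_forall_restrict fun k =>
          (Finset.mem_filter.mp (h_all ▸ Finset.mem_univ k : k ∈ J)).2
      simp only [hS, h_ins, hi, not_false_eq_true, and_self, if_true]
      omega
    · have h_lt : J.card < r := by
        simpa using Finset.card_lt_univ_of_notMem
          (not_forall.mp fun h => h_all (Finset.eq_univ_iff_forall.mpr h)).choose_spec
      simp only [hS, hi, not_false_eq_true, and_self, if_true]
      exact (Nat.le_sub_one_of_lt h_lt).trans (Nat.le_mul_of_pos_right _ (by omega))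

theorem sum_shatterStrength_restrict_le {n r : ℕ} (hr : 2 ≤ r)
    (H : Set (Fin n → Option (Fin r))) (i : Fin n) :
    ∑ j : Fin r, shatterStrength n r {h ∈ H | h i = some j} ≤
      (r - 1) * shatterStrength n r H := by
  classical
  have h_ins : (Finset.univ.filter fun S => IsShattered n r H (insert i S) ∧ i ∉ S).card ≤
      ((Finset.univ.filter (IsShattered n r H)).filter fun S => i ∈ S).card := by
    refine Finset.card_le_card_of_injOn (insert i) (fun S hS => ?_) fun S hS T hT hST => ?_
    · simp_all
    · simp only [Finset.coe_filter, Finset.mem_univ, true_and, Set.mem_ofPred_eq] at hS hT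
      rw [← Finset.erase_insert hS.2, ← Finset.erase_insert hT.2, hST]
  calc ∑ j : Fin r, shatterStrength n r {h ∈ H | h i = some j}
      = ∑ S : Finset (Fin n),
          (Finset.univ.filter fun j => IsShattered n r {h ∈ H | h i = some j} S).card := by
        simp only [shatterStrength_eq_card, Finset.card_filter]
        exact Finset.sum_comm
    _ ≤ ∑ S : Finset (Fin n), (r - 1) * ((if IsShattered n r H S ∧ i ∉ S then 1 else 0) +
          (if IsShattered n r H (insert i S) ∧ i ∉ S then 1 else 0)) :=
        Finset.sum_le_sum fun S _ => card_restrict_shattering_le hr H i S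
    _ = (r - 1) * (((Finset.univ.filter (IsShattered n r H)).filter fun S => i ∉ S).card +
          (Finset.univ.filter fun S => IsShattered n r H (insert i S) ∧ i ∉ S).card) := by
        rw [← Finset.mul_sum, Finset.sum_add_distrib, Finset.filter_filter,
          Finset.card_filter, Finset.card_filter]
    _ ≤ (r - 1) * shatterStrength n r H := by
        rw [shatterStrength_eq_card,
          ← Finset.card_filter_add_card_filter_not (s := Finset.univ.filter (IsShattered n r H))
            (fun S => i ∈ S), add_comm]
        gcongr

/-- For every coordinate `i`, there is a value `j` with
`s(H_{i→j}) ≤ ((r-1)/r)·s(H)`, where `H_{i→j} = {h ∈ H : h i = j}`. -/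
theorem stmt3 (r n : ℕ) (hr : 2 ≤ r) (hn : 1 ≤ n)
    (H : Set (Fin n → Option (Fin r))) (i : Fin n) :
    ∃ j : Fin r,
      (shatterStrength n r {h ∈ H | h i = some j} : ℝ) ≤
        (((r : ℝ) - 1) / (r : ℝ)) * (shatterStrength n r H : ℝ) := by
  have hr0 : (0 : ℝ) < r := by positivity
  have : Nonempty (Fin r) := ⟨⟨0, by omega⟩⟩
  have h_sum : ∑ j : Fin r, (shatterStrength n r {h ∈ H | h i = some j} : ℝ) ≤
      ((r : ℝ) - 1) * shatterStrength n r H := by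
    rw [← Nat.cast_one, ← Nat.cast_sub (by omega : 1 ≤ r)]
    exact_mod_cast sum_shatterStrength_restrict_le hr H i
  obtain ⟨j, -, hj⟩ := Finset.exists_le_of_sum_le (s := (Finset.univ : Finset (Fin r)))
    (f := fun j => (shatterStrength n r {h ∈ H | h i = some j} : ℝ))
    (g := fun _ => (((r : ℝ) - 1) / (r : ℝ)) * (shatterStrength n r H : ℝ))
    Finset.univ_nonempty (h_sum.trans_eq (by
      rw [Finset.sum_const, Finset.card_univ, Fintype.card_fin, nsmul_eq_mul]
      field_simp))
  exact ⟨j, hj⟩
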